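/- arXiv:2310.05027 — 3 statements merged into one kernel-verified Lean document; each statement's English description precedes it below -/
import Mathlib

section
/- Let a1=(x1,y1,z1), a2=(x2,y2,z2), a3=(x3,y3,z3), a4=(x4,y4,z4) be four affinely independent points in ℝ³, let D be the solid tetrahedron given by their convex hull, and let V be the Lebesgue volume of D. Then ∫_D (x² + z²) dV = V·(x1² + x1x2 + x2² + x1x3 + x2x3 + x3² + x1x4 + x2x4 + x3x4 + x4² + z1² + z1z2 + z2² + z1z3 + z2z3 + z3² + z1z4 + z2z4 + z3z4 + z4²)/10. -/
open MeasureTheory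

/-- The simplex spanned by the origin and the standard basis vectors. -/
def cornerSimplex (n : ℕ) : Set (EuclideanSpace ℝ (Fin n)) :=
  {x | (∀ i, 0 ≤ x i) ∧ ∑ i, x i ≤ 1}

/-- The linear map sending the standard basis to the edges at `a 0` of the simplex `a`. -/
noncomputable def edgeMap {n : ℕ} (a : Fin (n + 1) → EuclideanSpace ℝ (Fin n)) :
    EuclideanSpace ℝ (Fin n) →L[ℝ] EuclideanSpace ℝ (Fin n) :=
  LinearMap.toContinuousLinearMap
    (Fintype.linearCombination ℝ (fun i : Fin n => a i.succ - a 0) ∘ₗ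
      (WithLp.linearEquiv 2 ℝ (Fin n → ℝ)).toLinearMap)

lemma edgeMap_apply {n : ℕ} (a : Fin (n + 1) → EuclideanSpace ℝ (Fin n))
    (x : EuclideanSpace ℝ (Fin n)) :
    edgeMap a x = ∑ i, x i • (a i.succ - a 0) := by
  simp [edgeMap, Fintype.linearCombination_apply]

lemma edgeMap_injective {n : ℕ} {a : Fin (n + 1) → EuclideanSpace ℝ (Fin n)}
    (h : AffineIndependent ℝ a) : Function.Injective (edgeMap a) := by
  have hli : LinearIndependent ℝ (fun i : Fin n => a i.succ - a 0) :=
    ((affineIndependent_iff_linearIndependent_vsub ℝ a 0).1 h).comp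
      (fun i : Fin n => (⟨i.succ, Fin.succ_ne_zero i⟩ : {x : Fin (n + 1) // x ≠ 0}))
      fun i j hij => Fin.succ_injective _ (Subtype.ext_iff.1 hij)
  rw [injective_iff_map_eq_zero]
  intro x hx
  rw [edgeMap_apply] at hx
  ext i
  exact Fintype.linearIndependent_iff.1 hli _ hx i

lemma convex_cornerSimplex (n : ℕ) : Convex ℝ (cornerSimplex n) := by
  rintro x ⟨hx, hx'⟩ y ⟨hy, hy'⟩ s t hs ht hst
  refine ⟨fun i => ?_, ?_⟩
  · have := mul_nonneg hs (hx i)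
    have := mul_nonneg ht (hy i)
    simp only [PiLp.add_apply, PiLp.smul_apply, smul_eq_mul]
    linarith
  · simp only [PiLp.add_apply, PiLp.smul_apply, smul_eq_mul, Finset.sum_add_distrib,
      ← Finset.mul_sum]
    nlinarith

lemma isClosed_cornerSimplex (n : ℕ) : IsClosed (cornerSimplex n) := by
  simp only [cornerSimplex, Set.ofPred_and, Set.ofPred_forall]
  exact (isClosed_iInter fun i => isClosed_le (by fun_prop) (by fun_prop)).inter
    (isClosed_le (by fun_prop) (by fun_prop))

lemma convexHull_range_eq_image_cornerSimplex {n : ℕ}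
    (a : Fin (n + 1) → EuclideanSpace ℝ (Fin n)) :
    convexHull ℝ (Set.range a) = (fun x => a 0 + edgeMap a x) '' cornerSimplex n := by
  apply Set.Subset.antisymm
  · apply convexHull_min
    · rintro _ ⟨i, rfl⟩
      refine Fin.cases ?_ (fun j => ?_) i
      · exact ⟨0, ⟨by simp, by simp⟩, by simp⟩
      · refine ⟨EuclideanSpace.single j 1, ⟨fun k => ?_, ?_⟩, ?_⟩
        · by_cases hk : k = j <;> simp [hk]
        · simp
        · simp [edgeMap_apply]
    · have := ((convex_cornerSimplex n).linear_image (edgeMap a).toLinearMap).translate (a 0)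
      rw [Set.image_image] at this
      exact this
  · rintro _ ⟨x, ⟨hx, hx'⟩, rfl⟩
    have key := (convex_convexHull ℝ (Set.range a)).sum_mem (t := Finset.univ)
      (w := Fin.cons (1 - ∑ i, x i) x) (z := a)
      (fun i _ => Fin.cases (by simpa using hx') (fun j => by simpa using hx j) i)
      (by simp [Fin.sum_univ_succ])
      (fun i _ => subset_convexHull ℝ _ ⟨i, rfl⟩)
    convert key using 1
    simp only [Fin.sum_univ_succ, Fin.cons_zero, Fin.cons_succ, edgeMap_apply, smul_sub,
      Finset.sum_sub_distrib, ← Finset.sum_smul, sub_smul, one_smul]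
    abel

lemma setIntegral_convexHull_range {n : ℕ} {a : Fin (n + 1) → EuclideanSpace ℝ (Fin n)}
    (h : AffineIndependent ℝ a) (f : EuclideanSpace ℝ (Fin n) → ℝ) :
    ∫ x in convexHull ℝ (Set.range a), f x =
      |(edgeMap a).det| * ∫ x in cornerSimplex n, f (a 0 + edgeMap a x) := by
  rw [convexHull_range_eq_image_cornerSimplex,
    integral_image_eq_integral_abs_det_fderiv_smul volume (f' := fun _ => edgeMap a)
      (isClosed_cornerSimplex n).measurableSet
      (fun x _ => ((edgeMap a).hasFDerivAt.const_add (a 0)).hasFDerivWithinAt)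
      (fun x _ y _ hxy => edgeMap_injective h (add_left_cancel hxy))]
  simp only [smul_eq_mul, integral_const_mul]

lemma setIntegral_under_graph {α : Type*} [MeasurableSpace α] {μ : Measure α} [SFinite μ]
    {s : Set α} (hs : MeasurableSet s) {u : α → ℝ} (hu : ∀ y ∈ s, 0 ≤ u y)
    {R : Set (ℝ × α)} (hR : MeasurableSet R)
    (hRmem : ∀ p, p ∈ R ↔ p.2 ∈ s ∧ p.1 ∈ Set.Icc 0 (u p.2))
    {f : ℝ × α → ℝ} (hf : IntegrableOn f R (volume.prod μ)) :
    ∫ p in R, f p ∂(volume.prod μ) = ∫ y in s, (∫ t in (0 : ℝ)..u y, f (t, y)) ∂μ := by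
  rw [← integral_indicator hR, integral_prod_symm _ ((integrable_indicator_iff hR).2 hf),
    ← integral_indicator hs]
  congr 1 with y
  by_cases hy : y ∈ s
  · rw [Set.indicator_of_mem hy, intervalIntegral.integral_of_le (hu y hy),
      ← integral_Icc_eq_integral_Ioc, ← integral_indicator measurableSet_Icc]
    congr 1 with t
    simp only [Set.indicator, hRmem, hy, true_and]
  · simp [hRmem, hy]

lemma integral_quartic (c₀ c₁ c₂ c₃ c₄ s : ℝ) :
    ∫ t in (0 : ℝ)..s, (c₀ + c₁ * t + c₂ * t ^ 2 + c₃ * t ^ 3 + c₄ * t ^ 4) =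
      c₀ * s + c₁ * s ^ 2 / 2 + c₂ * s ^ 3 / 3 + c₃ * s ^ 4 / 4 + c₄ * s ^ 5 / 5 := by
  have hd : ∀ t ∈ Set.uIcc 0 s, HasDerivAt
      (fun t : ℝ => c₀ * t + c₁ * t ^ 2 / 2 + c₂ * t ^ 3 / 3 + c₃ * t ^ 4 / 4 + c₄ * t ^ 5 / 5)
      (c₀ + c₁ * t + c₂ * t ^ 2 + c₃ * t ^ 3 + c₄ * t ^ 4) t := by
    intro t _
    have hp (c d : ℝ) (n : ℕ) := ((hasDerivAt_pow n t).const_mul c).div_const d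
    refine HasDerivAt.congr_deriv (((((hasDerivAt_id t).const_mul c₀).add (hp c₁ 2 2)).add
      (hp c₂ 3 3)).add (hp c₃ 4 4) |>.add (hp c₄ 5 5)) ?_
    push_cast
    ring
  rw [intervalIntegral.integral_eq_sub_of_hasDerivAt hd
    (Continuous.intervalIntegrable (by fun_prop) _ _)]
  ring

lemma setIntegral_triangle {f : ℝ × ℝ → ℝ} (hf : Continuous f) :
    ∫ p in {p : ℝ × ℝ | p.2 ∈ Set.Icc 0 1 ∧ p.1 ∈ Set.Icc 0 (1 - p.2)}, f p =
      ∫ y in (0 : ℝ)..1, ∫ x in (0 : ℝ)..(1 - y), f (x, y) := by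
  set R : Set (ℝ × ℝ) := {p | p.2 ∈ Set.Icc 0 1 ∧ p.1 ∈ Set.Icc 0 (1 - p.2)} with hR
  have hcl : IsClosed R := by
    simp only [hR, Set.mem_Icc, Set.ofPred_and]
    refine ((isClosed_le ?_ ?_).inter (isClosed_le ?_ ?_)).inter
      ((isClosed_le ?_ ?_).inter (isClosed_le ?_ ?_)) <;> fun_prop
  have hc : IsCompact R := by
    refine (isCompact_Icc (a := (0 : ℝ × ℝ)) (b := 1)).of_isClosed_subset hcl ?_
    rintro ⟨x, y⟩ ⟨⟨hy, hy'⟩, hx, hx'⟩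
    simp only at hx hx' hy hy'
    exact ⟨⟨hx, hy⟩, by simp only [Prod.fst_one]; linarith, hy'⟩
  rw [intervalIntegral.integral_of_le zero_le_one, ← integral_Icc_eq_integral_Ioc]
  exact setIntegral_under_graph measurableSet_Icc (u := fun y => 1 - y)
    (fun y hy => by linarith [hy.2]) hcl.measurableSet (fun p => Iff.rfl)
    (hf.continuousOn.integrableOn_compact hc)

lemma setIntegral_cornerSimplex_two {f : (Fin 2 → ℝ) → ℝ} (hf : Continuous f) :
    ∫ q in {q : Fin 2 → ℝ | q 1 ∈ Set.Icc 0 1 ∧ q 0 ∈ Set.Icc 0 (1 - q 1)}, f q =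
      ∫ y in (0 : ℝ)..1, ∫ x in (0 : ℝ)..(1 - y), f ![x, y] := by
  rw [← setIntegral_triangle (f := fun p => f ![p.1, p.2]) (by fun_prop),
    ← (volume_preserving_finTwoArrow ℝ).setIntegral_preimage_emb
      MeasurableEquiv.finTwoArrow.measurableEmbedding]
  congr 1 with q
  congr 1
  ext i
  fin_cases i <;> rfl

lemma setIntegral_cornerSimplex_three {f : ℝ × (Fin 2 → ℝ) → ℝ} (hf : Continuous f)
    (hg : Continuous fun q : Fin 2 → ℝ => ∫ t in (0 : ℝ)..(1 - q 0 - q 1), f (t, q)) :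
    ∫ x in cornerSimplex 3, f (x 0, ![x 1, x 2]) =
      ∫ z in (0 : ℝ)..1, ∫ y in (0 : ℝ)..(1 - z), ∫ x in (0 : ℝ)..(1 - y - z), f (x, ![y, z]) := by
  set S : Set (Fin 2 → ℝ) := {q | q 1 ∈ Set.Icc 0 1 ∧ q 0 ∈ Set.Icc 0 (1 - q 1)} with hS
  set R : Set (ℝ × (Fin 2 → ℝ)) := {p | p.2 ∈ S ∧ p.1 ∈ Set.Icc 0 (1 - p.2 0 - p.2 1)} with hR
  have hSm : MeasurableSet S := by
    apply IsClosed.measurableSet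
    simp only [hS, Set.mem_Icc, Set.ofPred_and]
    refine ((isClosed_le ?_ ?_).inter (isClosed_le ?_ ?_)).inter
      ((isClosed_le ?_ ?_).inter (isClosed_le ?_ ?_)) <;> fun_prop
  have hcl : IsClosed R := by
    simp only [hR, hS, Set.mem_Icc, Set.ofPred_and, Set.mem_inter_iff, Set.mem_ofPred_eq]
    refine (((isClosed_le ?_ ?_).inter (isClosed_le ?_ ?_)).inter
      ((isClosed_le ?_ ?_).inter (isClosed_le ?_ ?_))).inter
      ((isClosed_le ?_ ?_).inter (isClosed_le ?_ ?_)) <;> fun_prop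
  have hc : IsCompact R := by
    refine (isCompact_Icc (a := (0 : ℝ × (Fin 2 → ℝ))) (b := 1)).of_isClosed_subset hcl ?_
    rintro ⟨x, q⟩ ⟨⟨⟨hz, hz'⟩, hy, hy'⟩, hx, hx'⟩
    simp only at hx hx' hy hy' hz hz'
    refine ⟨⟨hx, fun i => ?_⟩, by simp only [Prod.fst_one]; linarith, fun i => ?_⟩ <;>
      fin_cases i <;> simp <;> linarith
  have key := setIntegral_under_graph (μ := volume) hSm (u := fun q => 1 - q 0 - q 1)
    (fun q hq => by linarith [hq.2.2]) hcl.measurableSet (fun p => Iff.rfl)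
    (hf.continuousOn.integrableOn_compact hc)
  rw [setIntegral_cornerSimplex_two hg] at key
  refine Eq.trans ?_ key
  have hmp := (volume_preserving_piFinSuccAbove (fun _ : Fin 3 => ℝ) 0).comp
    (EuclideanSpace.volume_preserving_symm_measurableEquiv_toLp (Fin 3))
  rw [← Measure.volume_eq_prod, ← hmp.setIntegral_preimage_emb
    ((MeasurableEquiv.piFinSuccAbove (fun _ : Fin 3 => ℝ) 0).measurableEmbedding.comp
      (MeasurableEquiv.toLp 2 (Fin 3 → ℝ)).symm.measurableEmbedding)]
  have hval (x : EuclideanSpace ℝ (Fin 3)) : (MeasurableEquiv.piFinSuccAbove (fun _ => ℝ) 0 ∘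
      (MeasurableEquiv.toLp 2 (Fin 3 → ℝ)).symm) x = (x 0, ![x 1, x 2]) := by
    refine Prod.ext rfl ?_
    ext i
    fin_cases i <;> rfl
  have hset : (MeasurableEquiv.piFinSuccAbove (fun _ => ℝ) 0 ∘
      (MeasurableEquiv.toLp 2 (Fin 3 → ℝ)).symm) ⁻¹' R = cornerSimplex 3 := by
    ext x
    rw [Set.mem_preimage, hval]
    simp only [hR, hS, cornerSimplex, Set.mem_ofPred_eq, Set.mem_Icc, Fin.sum_univ_three,
      Fin.forall_fin_succ, Matrix.cons_val_zero, Matrix.cons_val_one]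
    simp
    grind
  rw [hset]
  simp only [hval]

lemma setIntegral_cornerSimplex_sq (α β γ δ : ℝ) :
    ∫ x in cornerSimplex 3, (α + β * x 0 + γ * x 1 + δ * x 2) ^ 2 =
      (10 * α ^ 2 + 5 * α * (β + γ + δ) + β ^ 2 + γ ^ 2 + δ ^ 2 + β * γ + β * δ + γ * δ) / 60 := by
  have h₁ (y z : ℝ) : ∫ x in (0 : ℝ)..(1 - y - z), (α + β * x + γ * y + δ * z) ^ 2 =
      (α + γ * y + δ * z) ^ 2 * (1 - y - z) + (α + γ * y + δ * z) * β * (1 - y - z) ^ 2 +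
        β ^ 2 * (1 - y - z) ^ 3 / 3 := by
    have := integral_quartic ((α + γ * y + δ * z) ^ 2) (2 * (α + γ * y + δ * z) * β) (β ^ 2) 0 0
      (1 - y - z)
    convert this using 1
    · congr 1 with x
      ring
    · ring
  have h₂ (z : ℝ) : ∫ y in (0 : ℝ)..(1 - z), ((α + γ * y + δ * z) ^ 2 * (1 - y - z) +
        (α + γ * y + δ * z) * β * (1 - y - z) ^ 2 + β ^ 2 * (1 - y - z) ^ 3 / 3) =
      (α + δ * z) ^ 2 * (1 - z) ^ 2 / 2 + (α + δ * z) * (γ + β) * (1 - z) ^ 3 / 3 +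
        (γ ^ 2 + γ * β + β ^ 2) * (1 - z) ^ 4 / 12 := by
    have := integral_quartic
      ((α + δ * z) ^ 2 * (1 - z) + (α + δ * z) * β * (1 - z) ^ 2 + β ^ 2 * (1 - z) ^ 3 / 3)
      (2 * (α + δ * z) * γ * (1 - z) - (α + δ * z) ^ 2 + γ * β * (1 - z) ^ 2
        - 2 * (α + δ * z) * β * (1 - z) - β ^ 2 * (1 - z) ^ 2)
      (γ ^ 2 * (1 - z) - 2 * (α + δ * z) * γ - 2 * γ * β * (1 - z) + (α + δ * z) * β
        + β ^ 2 * (1 - z))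
      (-γ ^ 2 + γ * β - β ^ 2 / 3) 0 (1 - z)
    convert this using 1
    · congr 1 with y
      ring
    · ring
  have h₃ : ∫ z in (0 : ℝ)..1, ((α + δ * z) ^ 2 * (1 - z) ^ 2 / 2 +
        (α + δ * z) * (γ + β) * (1 - z) ^ 3 / 3 +
        (γ ^ 2 + γ * β + β ^ 2) * (1 - z) ^ 4 / 12) =
      (10 * α ^ 2 + 5 * α * (β + γ + δ) + β ^ 2 + γ ^ 2 + δ ^ 2 + β * γ + β * δ + γ * δ) / 60 := by
    have := integral_quartic
      (α ^ 2 / 2 + α * (γ + β) / 3 + (γ ^ 2 + γ * β + β ^ 2) / 12)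
      (α * δ - α ^ 2 + (δ - 3 * α) * (γ + β) / 3 - (γ ^ 2 + γ * β + β ^ 2) / 3)
      ((δ ^ 2 - 4 * α * δ + α ^ 2) / 2 + (α - δ) * (γ + β) + (γ ^ 2 + γ * β + β ^ 2) / 2)
      (α * δ - δ ^ 2 + (3 * δ - α) * (γ + β) / 3 - (γ ^ 2 + γ * β + β ^ 2) / 3)
      (δ ^ 2 / 2 - δ * (γ + β) / 3 + (γ ^ 2 + γ * β + β ^ 2) / 12) 1
    convert this using 1
    · congr 1 with z
      ring
    · ring
  have := setIntegral_cornerSimplex_three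
    (f := fun p => (α + β * p.1 + γ * p.2 0 + δ * p.2 1) ^ 2) (by fun_prop)
    (by simp only [h₁]; fun_prop)
  simpa [h₁, h₂, h₃] using this

lemma volume_real_convexHull_range {a : Fin 4 → EuclideanSpace ℝ (Fin 3)}
    (h : AffineIndependent ℝ a) :
    (volume (convexHull ℝ (Set.range a))).toReal = |(edgeMap a).det| / 6 := by
  have h₁ := setIntegral_convexHull_range h (fun _ => 1)
  have h₂ := setIntegral_cornerSimplex_sq 1 0 0 0
  simp only [zero_mul, add_zero, one_pow] at h₂
  rw [h₂, setIntegral_const, smul_eq_mul, mul_one, measureReal_def] at h₁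
  rw [h₁]
  ring

lemma setIntegral_convexHull_range_coord_sq {a : Fin 4 → EuclideanSpace ℝ (Fin 3)}
    (h : AffineIndependent ℝ a) (i : Fin 3) :
    ∫ x in convexHull ℝ (Set.range a), x i ^ 2 =
      (volume (convexHull ℝ (Set.range a))).toReal *
        (a 0 i ^ 2 + a 0 i * a 1 i + a 1 i ^ 2 + a 0 i * a 2 i + a 1 i * a 2 i + a 2 i ^ 2 +
          a 0 i * a 3 i + a 1 i * a 3 i + a 2 i * a 3 i + a 3 i ^ 2) / 10 := by
  have hval (x : EuclideanSpace ℝ (Fin 3)) : (a 0 + edgeMap a x) i =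
      a 0 i + (a 1 i - a 0 i) * x 0 + (a 2 i - a 0 i) * x 1 + (a 3 i - a 0 i) * x 2 := by
    simp [edgeMap_apply, Fin.sum_univ_three]
    ring_nf
  rw [setIntegral_convexHull_range h (fun x => x i ^ 2), volume_real_convexHull_range h]
  simp only [hval]
  rw [setIntegral_cornerSimplex_sq]
  ring

theorem stmt_1 (a₁ a₂ a₃ a₄ : EuclideanSpace ℝ (Fin 3))
    (h : AffineIndependent ℝ ![a₁, a₂, a₃, a₄]) :
    ∫ x in convexHull ℝ {a₁, a₂, a₃, a₄}, ((x 0) ^ 2 + (x 2) ^ 2) =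
      (volume (convexHull ℝ {a₁, a₂, a₃, a₄} : Set (EuclideanSpace ℝ (Fin 3)))).toReal *
        (a₁ 0 ^ 2 + a₁ 0 * a₂ 0 + a₂ 0 ^ 2 + a₁ 0 * a₃ 0 + a₂ 0 * a₃ 0 + a₃ 0 ^ 2 + a₁ 0 * a₄ 0 + a₂ 0 * a₄ 0 + a₃ 0 * a₄ 0 + a₄ 0 ^ 2 + a₁ 2 ^ 2 + a₁ 2 * a₂ 2 + a₂ 2 ^ 2 + a₁ 2 * a₃ 2 + a₂ 2 * a₃ 2 + a₃ 2 ^ 2 + a₁ 2 * a₄ 2 + a₂ 2 * a₄ 2 + a₃ 2 * a₄ 2 + a₄ 2 ^ 2) / 10 := by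
  have hr : ({a₁, a₂, a₃, a₄} : Set (EuclideanSpace ℝ (Fin 3))) =
      Set.range ![a₁, a₂, a₃, a₄] := by
    simp only [Matrix.range_cons, Matrix.range_empty, Set.union_empty, Set.singleton_union]
  have hc : IsCompact (convexHull ℝ (Set.range ![a₁, a₂, a₃, a₄])) :=
    (Set.finite_range _).isCompact_convexHull ℝ
  have hi (i : Fin 3) : IntegrableOn (fun x : EuclideanSpace ℝ (Fin 3) => x i ^ 2)
      (convexHull ℝ (Set.range ![a₁, a₂, a₃, a₄])) :=
    (by fun_prop : Continuous fun x : EuclideanSpace ℝ (Fin 3) => x i ^ 2).continuousOn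
      |>.integrableOn_compact hc
  rw [hr, integral_add (hi 0) (hi 2), setIntegral_convexHull_range_coord_sq h,
    setIntegral_convexHull_range_coord_sq h]
  simp only [Matrix.cons_val]
  ring
end

section
/- Let a1=(x1,y1,z1), a2=(x2,y2,z2), a3=(x3,y3,z3), a4=(x4,y4,z4) be four affinely independent points in ℝ³, let D be the solid tetrahedron given by their convex hull, and let V be the Lebesgue volume of D. Then ∫_D xz dV = V·(2x1z1 + x2z1 + x3z1 + x4z1 + x1z2 + 2x2z2 + x3z2 + x4z2 + x1z3 + x2z3 + 2x3z3 + x4z3 + x1z4 + x2z4 + x3z4 + 2x4z4)/20. -/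
open MeasureTheory

/-- Integration over a set in a product whose first coordinate ranges in `[0, c]`, by slices. -/
lemma setIntegral_prod_slices {Y : Type*} [MeasureSpace Y] [SFinite (volume : Measure Y)]
    {c : ℝ} (hc : 0 ≤ c) {U : Set (ℝ × Y)} (hU : MeasurableSet U)
    (hUc : ∀ p ∈ U, p.1 ∈ Set.Icc 0 c) {F : ℝ × Y → ℝ} (hF : IntegrableOn F U) :
    ∫ p in U, F p = ∫ s in (0 : ℝ)..c, ∫ y in Prod.mk s ⁻¹' U, F (s, y) := by
  rw [← integral_indicator hU, Measure.volume_eq_prod,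
    integral_prod _ ((integrable_indicator_iff hU).2 hF),
    intervalIntegral.integral_of_le hc, ← integral_Icc_eq_integral_Ioc,
    ← integral_indicator measurableSet_Icc]
  congr 1
  funext s
  by_cases hs : s ∈ Set.Icc 0 c
  · rw [Set.indicator_of_mem hs, ← integral_indicator (measurable_prodMk_left hU)]
    rfl
  · rw [Set.indicator_of_notMem hs]
    have h0 (y : Y) : U.indicator F (s, y) = 0 :=
      Set.indicator_of_notMem (fun h => hs (hUc _ h)) _
    simp [h0]

/-- The standard solid triangle scaled by `c`. -/
def solidTriangle (c : ℝ) : Set (ℝ × ℝ) := {p | 0 ≤ p.1 ∧ 0 ≤ p.2 ∧ p.1 + p.2 ≤ c}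

/-- The standard solid tetrahedron. -/
def solidTetrahedron : Set (ℝ × ℝ × ℝ) :=
  {p | 0 ≤ p.1 ∧ 0 ≤ p.2.1 ∧ 0 ≤ p.2.2 ∧ p.1 + p.2.1 + p.2.2 ≤ 1}

lemma isCompact_solidTriangle (c : ℝ) : IsCompact (solidTriangle c) := by
  refine (isCompact_Icc (a := ((0 : ℝ), (0 : ℝ))) (b := (c, c))).of_isClosed_subset ?_ ?_
  · simp only [solidTriangle, Set.ofPred_and]
    refine .inter ?_ (.inter ?_ ?_) <;> exact isClosed_le (by fun_prop) (by fun_prop)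
  · rintro ⟨t, u⟩ ⟨ht, hu, h⟩
    simp only at ht hu h
    exact ⟨⟨ht, hu⟩, ⟨by simp only; linarith, by simp only; linarith⟩⟩

lemma isCompact_solidTetrahedron : IsCompact solidTetrahedron := by
  refine (isCompact_Icc (a := ((0 : ℝ), (0 : ℝ), (0 : ℝ))) (b := (1, 1, 1))).of_isClosed_subset
    ?_ ?_
  · simp only [solidTetrahedron, Set.ofPred_and]
    refine .inter ?_ (.inter ?_ (.inter ?_ ?_)) <;> exact isClosed_le (by fun_prop) (by fun_prop)
  · rintro ⟨s, t, u⟩ ⟨hs, ht, hu, h⟩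
    simp only at hs ht hu h
    exact ⟨⟨hs, ht, hu⟩, ⟨by simp only; linarith, by simp only; linarith, by simp only; linarith⟩⟩

lemma setIntegral_solidTriangle {c : ℝ} (hc : 0 ≤ c) {F : ℝ × ℝ → ℝ} (hF : Continuous F) :
    ∫ p in solidTriangle c, F p = ∫ t in (0 : ℝ)..c, ∫ u in (0 : ℝ)..(c - t), F (t, u) := by
  have hK := isCompact_solidTriangle c
  rw [setIntegral_prod_slices hc hK.measurableSet ?_ (hF.continuousOn.integrableOn_compact hK)]
  · refine intervalIntegral.integral_congr fun t ht => ?_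
    rw [Set.uIcc_of_le hc] at ht
    have hslice : Prod.mk t ⁻¹' solidTriangle c = Set.Icc 0 (c - t) := by
      ext u
      simp only [solidTriangle, Set.mem_preimage, Set.mem_ofPred_eq, Set.mem_Icc, ht.1, true_and,
        le_sub_iff_add_le']
    simp only [hslice]
    rw [intervalIntegral.integral_of_le (by linarith [ht.2]), integral_Icc_eq_integral_Ioc]
  · rintro ⟨t, u⟩ ⟨ht, hu, h⟩
    simp only at ht hu h
    exact ⟨ht, by simp only; linarith⟩

lemma setIntegral_solidTetrahedron {F : ℝ × ℝ × ℝ → ℝ} (hF : Continuous F) :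
    ∫ p in solidTetrahedron, F p =
      ∫ s in (0 : ℝ)..1, ∫ t in (0 : ℝ)..(1 - s), ∫ u in (0 : ℝ)..(1 - s - t), F (s, t, u) := by
  have hK := isCompact_solidTetrahedron
  rw [setIntegral_prod_slices zero_le_one hK.measurableSet ?_
    (hF.continuousOn.integrableOn_compact hK)]
  · refine intervalIntegral.integral_congr fun s hs => ?_
    rw [Set.uIcc_of_le zero_le_one] at hs
    have hslice : Prod.mk s ⁻¹' solidTetrahedron = solidTriangle (1 - s) := by
      ext p
      simp only [solidTetrahedron, solidTriangle, Set.mem_preimage, Set.mem_ofPred_eq, hs.1,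
        true_and, le_sub_iff_add_le', add_assoc]
    simp only [hslice]
    exact setIntegral_solidTriangle (by linarith [hs.2]) (by fun_prop)
  · rintro ⟨s, t, u⟩ ⟨hs, ht, hu, h⟩
    simp only at hs ht hu h
    exact ⟨hs, by simp only; linarith⟩

lemma integral_quartic_s4 {f : ℝ → ℝ} (c k₀ k₁ k₂ k₃ k₄ : ℝ)
    (hf : ∀ x, f x = k₀ + k₁ * x + k₂ * x ^ 2 + k₃ * x ^ 3 + k₄ * x ^ 4) :
    ∫ x in (0 : ℝ)..c, f x =
      k₀ * c + k₁ * c ^ 2 / 2 + k₂ * c ^ 3 / 3 + k₃ * c ^ 4 / 4 + k₄ * c ^ 5 / 5 := by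
  have hderiv (x : ℝ) : HasDerivAt
      (fun x => k₀ * x + k₁ * x ^ 2 / 2 + k₂ * x ^ 3 / 3 + k₃ * x ^ 4 / 4 + k₄ * x ^ 5 / 5)
      (f x) x := by
    have hpow (k : ℝ) (n : ℕ) : HasDerivAt (fun x : ℝ => k * x ^ n / n)
        (k * (n * x ^ (n - 1)) / n) x := ((hasDerivAt_pow n x).const_mul k).div_const _
    refine HasDerivAt.congr_deriv (((((hasDerivAt_id x).const_mul k₀).add (hpow k₁ 2)).add
      (hpow k₂ 3)).add (hpow k₃ 4) |>.add (hpow k₄ 5)) ?_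
    rw [hf]
    norm_num
    ring
  have hcont : Continuous f := by
    rw [funext hf]
    fun_prop
  rw [intervalIntegral.integral_eq_sub_of_hasDerivAt (fun x _ => hderiv x)
    (hcont.intervalIntegrable _ _)]
  ring

lemma setIntegral_solidTetrahedron_quadratic (q₀ q₁ q₂ q₃ q₄ q₅ q₆ q₇ q₈ q₉ : ℝ) :
    ∫ p in solidTetrahedron, (q₀ + q₁ * p.1 + q₂ * p.2.1 + q₃ * p.2.2 + q₄ * p.1 ^ 2 +
        q₅ * p.2.1 ^ 2 + q₆ * p.2.2 ^ 2 + q₇ * (p.1 * p.2.1) + q₈ * (p.1 * p.2.2) +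
        q₉ * (p.2.1 * p.2.2)) =
      (20 * q₀ + 5 * (q₁ + q₂ + q₃) + 2 * (q₄ + q₅ + q₆) + q₇ + q₈ + q₉) / 120 := by
  rw [setIntegral_solidTetrahedron (by fun_prop)]
  have inner (s t : ℝ) : ∫ u in (0 : ℝ)..(1 - s - t), (q₀ + q₁ * s + q₂ * t + q₃ * u + q₄ * s ^ 2 +
        q₅ * t ^ 2 + q₆ * u ^ 2 + q₇ * (s * t) + q₈ * (s * u) + q₉ * (t * u)) =
      (q₀ + q₁ * s + q₄ * s ^ 2 + (q₂ + q₇ * s) * t + q₅ * t ^ 2) * (1 - s - t) +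
        ((q₃ + q₈ * s) / 2 + q₉ / 2 * t) * (1 - s - t) ^ 2 + q₆ / 3 * (1 - s - t) ^ 3 := by
    rw [integral_quartic_s4 _ (q₀ + q₁ * s + q₄ * s ^ 2 + (q₂ + q₇ * s) * t + q₅ * t ^ 2)
      (q₃ + q₈ * s + q₉ * t) q₆ 0 0 (fun u => by ring)]
    ring
  have middle (A B C D E F c : ℝ) : ∫ t in (0 : ℝ)..c, ((A + B * t + C * t ^ 2) * (c - t) +
        (D + E * t) * (c - t) ^ 2 + F * (c - t) ^ 3) =
      A * c ^ 2 / 2 + B * c ^ 3 / 6 + C * c ^ 4 / 12 + D * c ^ 3 / 3 + E * c ^ 4 / 12 +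
        F * c ^ 4 / 4 := by
    rw [integral_quartic_s4 _ (A * c + D * c ^ 2 + F * c ^ 3)
      (-A + B * c - 2 * D * c + E * c ^ 2 - 3 * F * c ^ 2)
      (-B + C * c + D - 2 * E * c + 3 * F * c) (-C + E - F) 0 (fun t => by ring)]
    ring
  have outer (A B C D E F : ℝ) : ∫ s in (0 : ℝ)..1, ((A + B * s + C * s ^ 2) * (1 - s) ^ 2 +
        (D + E * s) * (1 - s) ^ 3 + F * (1 - s) ^ 4) =
      A / 3 + B / 12 + C / 30 + D / 4 + E / 20 + F / 5 := by
    rw [integral_quartic_s4 _ (A + D + F) (-2 * A + B - 3 * D + E - 4 * F)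
      (A - 2 * B + C + 3 * D - 3 * E + 6 * F) (B - 2 * C - D + 3 * E - 4 * F) (C - E + F)
      (fun s => by ring)]
    ring
  simp only [inner, middle]
  trans ∫ s in (0 : ℝ)..1, ((q₀ / 2 + q₁ / 2 * s + q₄ / 2 * s ^ 2) * (1 - s) ^ 2 +
    ((q₂ + q₃) / 6 + (q₇ + q₈) / 6 * s) * (1 - s) ^ 3 +
      (q₅ / 12 + q₉ / 24 + q₆ / 12) * (1 - s) ^ 4)
  · congr 1
    funext s
    ring
  · rw [outer]
    ring

section AffineParametrization

variable {E : Type*} [AddCommGroup E] [Module ℝ E]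

/-- The linear map sending the standard basis of `ℝ³` to `b₁, b₂, b₃`. -/
def tripleCombination (b₁ b₂ b₃ : E) : ℝ × ℝ × ℝ →ₗ[ℝ] E :=
  (LinearMap.toSpanSingleton ℝ E b₁).coprod
    ((LinearMap.toSpanSingleton ℝ E b₂).coprod (LinearMap.toSpanSingleton ℝ E b₃))

lemma tripleCombination_apply (b₁ b₂ b₃ : E) (p : ℝ × ℝ × ℝ) :
    tripleCombination b₁ b₂ b₃ p = p.1 • b₁ + (p.2.1 • b₂ + p.2.2 • b₃) := by
  simp [tripleCombination]

lemma tripleCombination_injective {a₁ a₂ a₃ a₄ : E}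
    (h : AffineIndependent ℝ ![a₁, a₂, a₃, a₄]) :
    Function.Injective (tripleCombination (a₂ - a₁) (a₃ - a₁) (a₄ - a₁)) := by
  rw [injective_iff_map_eq_zero]
  rintro ⟨s, t, u⟩ hp
  rw [tripleCombination_apply] at hp
  have key := affineIndependent_iff.1 h Finset.univ ![-(s + t + u), s, t, u]
    (by simp [Fin.sum_univ_four]; ring)
    (by
      rw [← hp]
      simp [Fin.sum_univ_four]
      module)
  have h1 := key 1 (Finset.mem_univ _)
  have h2 := key 2 (Finset.mem_univ _)
  have h3 := key 3 (Finset.mem_univ _)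
  simp at h1 h2 h3
  simp [h1, h2, h3]

lemma convex_solidTetrahedron : Convex ℝ solidTetrahedron := by
  rintro ⟨s, t, u⟩ ⟨hs, ht, hu, h⟩ ⟨s', t', u'⟩ ⟨hs', ht', hu', h'⟩ a b ha hb hab
  simp only at hs ht hu h hs' ht' hu' h'
  simp only [solidTetrahedron, Set.mem_ofPred_eq, Prod.smul_mk, Prod.mk_add_mk, smul_eq_mul]
  refine ⟨by positivity, by positivity, by positivity, ?_⟩
  nlinarith [mul_le_mul_of_nonneg_left h ha, mul_le_mul_of_nonneg_left h' hb]

lemma convexHull_eq_image_solidTetrahedron (a₁ a₂ a₃ a₄ : E) :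
    convexHull ℝ {a₁, a₂, a₃, a₄} =
      (fun p => a₁ + tripleCombination (a₂ - a₁) (a₃ - a₁) (a₄ - a₁) p) '' solidTetrahedron := by
  apply Set.Subset.antisymm
  · apply convexHull_min
    · rintro x (rfl | rfl | rfl | rfl)
      · exact ⟨(0, 0, 0), by simp [solidTetrahedron], by simp [tripleCombination_apply]⟩
      · exact ⟨(1, 0, 0), by simp [solidTetrahedron], by simp [tripleCombination_apply]⟩
      · exact ⟨(0, 1, 0), by simp [solidTetrahedron], by simp [tripleCombination_apply]⟩
      · exact ⟨(0, 0, 1), by simp [solidTetrahedron], by simp [tripleCombination_apply]⟩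
    · have := (convex_solidTetrahedron.linear_image
        (tripleCombination (a₂ - a₁) (a₃ - a₁) (a₄ - a₁))).translate a₁
      rwa [Set.image_image] at this
  · rintro _ ⟨⟨s, t, u⟩, ⟨hs, ht, hu, h⟩, rfl⟩
    simp only at hs ht hu h
    have hmem := (convex_convexHull ℝ {a₁, a₂, a₃, a₄}).sum_mem (t := Finset.univ)
      (w := ![1 - s - t - u, s, t, u]) (z := ![a₁, a₂, a₃, a₄])
      (by
        intro i _
        fin_cases i <;> simp <;> linarith)
      (by simp [Fin.sum_univ_four]; ring)
      (by
        intro i _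
        apply subset_convexHull
        fin_cases i <;> simp)
    convert hmem using 1
    simp [Fin.sum_univ_four, tripleCombination_apply]
    module

end AffineParametrization

theorem stmt_4 (a₁ a₂ a₃ a₄ : EuclideanSpace ℝ (Fin 3))
    (h : AffineIndependent ℝ ![a₁, a₂, a₃, a₄]) :
    ∫ x in convexHull ℝ {a₁, a₂, a₃, a₄}, (x 0 * x 2) =
      (volume (convexHull ℝ {a₁, a₂, a₃, a₄} : Set (EuclideanSpace ℝ (Fin 3)))).toReal *
        (2 * a₁ 0 * a₁ 2 + a₂ 0 * a₁ 2 + a₃ 0 * a₁ 2 + a₄ 0 * a₁ 2 + a₁ 0 * a₂ 2 + 2 * a₂ 0 * a₂ 2 + a₃ 0 * a₂ 2 + a₄ 0 * a₂ 2 + a₁ 0 * a₃ 2 + a₂ 0 * a₃ 2 + 2 * a₃ 0 * a₃ 2 + a₄ 0 * a₃ 2 + a₁ 0 * a₄ 2 + a₂ 0 * a₄ 2 + a₃ 0 * a₄ 2 + 2 * a₄ 0 * a₄ 2) / 20 := by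
  set L := tripleCombination (a₂ - a₁) (a₃ - a₁) (a₄ - a₁) with hL
  let e : (ℝ × ℝ × ℝ) ≃L[ℝ] EuclideanSpace ℝ (Fin 3) :=
    (LinearEquiv.ofInjectiveOfFinrankEq L (tripleCombination_injective h)
      (by simp)).toContinuousLinearEquiv
  let g : (ℝ × ℝ × ℝ) ≃ₜ EuclideanSpace ℝ (Fin 3) :=
    e.toHomeomorph.trans (Homeomorph.addLeft a₁)
  have hg (p : ℝ × ℝ × ℝ) : g p = a₁ + L p := rfl
  have hhull : convexHull ℝ {a₁, a₂, a₃, a₄} = g '' solidTetrahedron :=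
    convexHull_eq_image_solidTetrahedron a₁ a₂ a₃ a₄
  have hvolume : (volume : Measure (ℝ × ℝ × ℝ)).IsAddHaarMeasure :=
    Measure.prod.instIsAddHaarMeasure volume volume
  have hHaar : (Measure.map e volume).IsAddHaarMeasure := e.isAddHaarMeasure_map volume
  -- The parametrization pushes Lebesgue measure to a multiple of Lebesgue measure.
  obtain ⟨k, hk⟩ : ∃ k : NNReal, (volume : Measure (EuclideanSpace ℝ (Fin 3))) =
      k • Measure.map g volume := by
    have hmap : Measure.map g volume = Measure.map e volume := by
      have : (g : ℝ × ℝ × ℝ → _) = (fun x => a₁ + x) ∘ e := rfl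
      rw [this, ← Measure.map_map (by fun_prop) e.continuous.measurable, map_add_left_eq_self]
    rw [hmap]
    exact ⟨_, Measure.isAddLeftInvariant_eq_smul _ _⟩
  have hintegral (F : EuclideanSpace ℝ (Fin 3) → ℝ) :
      ∫ x in convexHull ℝ {a₁, a₂, a₃, a₄}, F x = k * ∫ p in solidTetrahedron, F (g p) := by
    rw [hhull, hk, Measure.restrict_smul, integral_smul_nnreal_measure,
      g.measurableEmbedding.setIntegral_map, g.injective.preimage_image, NNReal.smul_def,
      smul_eq_mul]
  have hone : ∫ _ in solidTetrahedron, (1 : ℝ) = 1 / 6 := by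
    have := setIntegral_solidTetrahedron_quadratic 1 0 0 0 0 0 0 0 0 0
    norm_num at this ⊢
    exact this
  have hvol : (volume (convexHull ℝ {a₁, a₂, a₃, a₄} : Set (EuclideanSpace ℝ (Fin 3)))).toReal =
      k / 6 := by
    have := hintegral fun _ => 1
    rw [hone, setIntegral_const, smul_eq_mul, mul_one, measureReal_def] at this
    rw [this]
    ring
  rw [hintegral, hvol]
  have hcoord (p : ℝ × ℝ × ℝ) (i : Fin 3) : g p i =
      a₁ i + (p.1 * (a₂ i - a₁ i) + (p.2.1 * (a₃ i - a₁ i) + p.2.2 * (a₄ i - a₁ i))) := by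
    simp [hg, hL, tripleCombination_apply]
  have hquad := setIntegral_solidTetrahedron_quadratic (a₁ 0 * a₁ 2)
    (a₁ 0 * (a₂ 2 - a₁ 2) + (a₂ 0 - a₁ 0) * a₁ 2)
    (a₁ 0 * (a₃ 2 - a₁ 2) + (a₃ 0 - a₁ 0) * a₁ 2)
    (a₁ 0 * (a₄ 2 - a₁ 2) + (a₄ 0 - a₁ 0) * a₁ 2)
    ((a₂ 0 - a₁ 0) * (a₂ 2 - a₁ 2))
    ((a₃ 0 - a₁ 0) * (a₃ 2 - a₁ 2))
    ((a₄ 0 - a₁ 0) * (a₄ 2 - a₁ 2))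
    ((a₂ 0 - a₁ 0) * (a₃ 2 - a₁ 2) + (a₃ 0 - a₁ 0) * (a₂ 2 - a₁ 2))
    ((a₂ 0 - a₁ 0) * (a₄ 2 - a₁ 2) + (a₄ 0 - a₁ 0) * (a₂ 2 - a₁ 2))
    ((a₃ 0 - a₁ 0) * (a₄ 2 - a₁ 2) + (a₄ 0 - a₁ 0) * (a₃ 2 - a₁ 2))
  convert congrArg (fun r => (k : ℝ) * r) hquad using 1
  · congr 2
    funext p
    rw [hcoord, hcoord]
    ring
  · ring
end

section
/- Let a1=(x1,y1,z1), a2=(x2,y2,z2), a3=(x3,y3,z3), a4=(x4,y4,z4) be four affinely independent points in ℝ³, let D be the solid tetrahedron given by their convex hull, and let V be the Lebesgue volume of D. Then ∫_D xy dV = V·(2x1y1 + x2y1 + x3y1 + x4y1 + x1y2 + 2x2y2 + x3y2 + x4y2 + x1y3 + x2y3 + 2x3y3 + x4y3 + x1y4 + x2y4 + x3y4 + 2x4y4)/20. -/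
open MeasureTheory

/-- Fubini over a set whose first coordinate runs over an interval. -/
lemma setIntegral_prod_fiber {β : Type*} [MeasureSpace β] [SFinite (volume : Measure β)]
    {s : ℝ} (hs : 0 ≤ s) {K : ℝ → Set β} {T : Set (ℝ × β)}
    (hT : ∀ x q, (x, q) ∈ T ↔ (0 ≤ x ∧ x ≤ s) ∧ q ∈ K x)
    (hm : MeasurableSet T) (hK : ∀ x, MeasurableSet (K x))
    {G : ℝ × β → ℝ} (hG : IntegrableOn G T) :
    ∫ p in T, G p = ∫ x in (0 : ℝ)..s, ∫ q in K x, G (x, q) := by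
  rw [← integral_indicator hm, Measure.volume_eq_prod,
    integral_prod _ ((integrable_indicator_iff hm).2 hG), intervalIntegral.integral_of_le hs,
    ← integral_Icc_eq_integral_Ioc, ← integral_indicator measurableSet_Icc]
  refine integral_congr_ae (.of_forall fun x ↦ ?_)
  by_cases hx : x ∈ Set.Icc 0 s
  · simp only [Set.indicator_of_mem hx]
    rw [← integral_indicator (hK x)]
    refine integral_congr_ae (.of_forall fun q ↦ ?_)
    have : (x, q) ∈ T ↔ q ∈ K x := by rw [hT]; exact and_iff_right hx
    by_cases hq : q ∈ K x
    · simp [hq, this]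
    · simp [hq, this]
  · have : ∀ q, (x, q) ∉ T := fun q h ↦ hx ((hT x q).1 h).1
    simp [Set.indicator_of_notMem hx, this]

/-- The triangle with legs of length `r` in the first quadrant. -/
def cornerTriangle (r : ℝ) : Set (ℝ × ℝ) := {p | 0 ≤ p.1 ∧ 0 ≤ p.2 ∧ p.1 + p.2 ≤ r}

/-- The unit simplex in the first octant. -/
def cornerTetrahedron : Set (ℝ × ℝ × ℝ) :=
  {p | 0 ≤ p.1 ∧ 0 ≤ p.2.1 ∧ 0 ≤ p.2.2 ∧ p.1 + p.2.1 + p.2.2 ≤ 1}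

lemma isCompact_cornerTriangle (r : ℝ) : IsCompact (cornerTriangle r) := by
  refine (isCompact_Icc (a := ((0, 0) : ℝ × ℝ)) (b := (r, r))).of_isClosed_subset ?_ ?_
  · have h1 : IsClosed {p : ℝ × ℝ | 0 ≤ p.1} := isClosed_le (by fun_prop) (by fun_prop)
    have h2 : IsClosed {p : ℝ × ℝ | 0 ≤ p.2} := isClosed_le (by fun_prop) (by fun_prop)
    have h3 : IsClosed {p : ℝ × ℝ | p.1 + p.2 ≤ r} := isClosed_le (by fun_prop) (by fun_prop)
    exact h1.inter (h2.inter h3)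
  · rintro ⟨y, z⟩ ⟨hy, hz, h⟩
    simp only at hy hz h
    exact ⟨⟨hy, hz⟩, ⟨by simp only; linarith, by simp only; linarith⟩⟩

lemma isCompact_cornerTetrahedron : IsCompact cornerTetrahedron := by
  refine (isCompact_Icc (a := ((0, 0, 0) : ℝ × ℝ × ℝ)) (b := (1, 1, 1))).of_isClosed_subset ?_ ?_
  · have h1 : IsClosed {p : ℝ × ℝ × ℝ | 0 ≤ p.1} := isClosed_le (by fun_prop) (by fun_prop)
    have h2 : IsClosed {p : ℝ × ℝ × ℝ | 0 ≤ p.2.1} := isClosed_le (by fun_prop) (by fun_prop)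
    have h3 : IsClosed {p : ℝ × ℝ × ℝ | 0 ≤ p.2.2} := isClosed_le (by fun_prop) (by fun_prop)
    have h4 : IsClosed {p : ℝ × ℝ × ℝ | p.1 + p.2.1 + p.2.2 ≤ 1} :=
      isClosed_le (by fun_prop) (by fun_prop)
    exact h1.inter (h2.inter (h3.inter h4))
  · rintro ⟨x, y, z⟩ ⟨hx, hy, hz, h⟩
    simp only at hx hy hz h
    exact ⟨⟨hx, hy, hz⟩,
      ⟨by simp only; linarith, by simp only; linarith, by simp only; linarith⟩⟩

lemma setIntegral_cornerTriangle {r : ℝ} (hr : 0 ≤ r) {G : ℝ × ℝ → ℝ} (hG : Continuous G) :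
    ∫ p in cornerTriangle r, G p = ∫ y in (0 : ℝ)..r, ∫ z in (0 : ℝ)..(r - y), G (y, z) := by
  have hc := isCompact_cornerTriangle r
  rw [setIntegral_prod_fiber hr (K := fun y ↦ Set.Icc 0 (r - y)) _ hc.measurableSet
    (fun _ ↦ measurableSet_Icc) (hG.continuousOn.integrableOn_compact hc)]
  · refine intervalIntegral.integral_congr fun y hy ↦ ?_
    rw [Set.uIcc_of_le hr] at hy
    rw [intervalIntegral.integral_of_le (by linarith [hy.2]), integral_Icc_eq_integral_Ioc]
  · intro y z
    simp only [cornerTriangle, Set.mem_ofPred_eq, Set.mem_Icc]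
    constructor
    · rintro ⟨h1, h2, h3⟩
      exact ⟨⟨h1, by linarith⟩, h2, by linarith⟩
    · rintro ⟨⟨h1, -⟩, h2, h3⟩
      exact ⟨h1, h2, by linarith⟩

lemma setIntegral_cornerTetrahedron {G : ℝ × ℝ × ℝ → ℝ} (hG : Continuous G) :
    ∫ p in cornerTetrahedron, G p =
      ∫ x in (0 : ℝ)..1, ∫ y in (0 : ℝ)..(1 - x), ∫ z in (0 : ℝ)..(1 - x - y), G (x, y, z) := by
  have hc := isCompact_cornerTetrahedron
  rw [setIntegral_prod_fiber zero_le_one (K := fun x ↦ cornerTriangle (1 - x)) _ hc.measurableSet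
    (fun x ↦ (isCompact_cornerTriangle _).measurableSet) (hG.continuousOn.integrableOn_compact hc)]
  · refine intervalIntegral.integral_congr fun x hx ↦ ?_
    rw [Set.uIcc_of_le zero_le_one] at hx
    exact setIntegral_cornerTriangle (G := fun q ↦ G (x, q)) (by linarith [hx.2]) (by fun_prop)
  · rintro x ⟨y, z⟩
    simp only [cornerTetrahedron, cornerTriangle, Set.mem_ofPred_eq]
    constructor
    · rintro ⟨h1, h2, h3, h4⟩
      exact ⟨⟨h1, by linarith⟩, h2, h3, by linarith⟩
    · rintro ⟨⟨h1, -⟩, h2, h3, h4⟩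
      exact ⟨h1, h2, h3, by linarith⟩

lemma intervalIntegral_quartic (s a b c d e : ℝ) :
    ∫ z in (0 : ℝ)..s, (a + b * z + c * z ^ 2 + d * z ^ 3 + e * z ^ 4) =
      a * s + b * s ^ 2 / 2 + c * s ^ 3 / 3 + d * s ^ 4 / 4 + e * s ^ 5 / 5 := by
  have hd : ∀ z ∈ Set.uIcc 0 s, HasDerivAt
      (fun z : ℝ ↦ a * z + b * z ^ 2 / 2 + c * z ^ 3 / 3 + d * z ^ 4 / 4 + e * z ^ 5 / 5)
      (a + b * z + c * z ^ 2 + d * z ^ 3 + e * z ^ 4) z := by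
    intro z _
    have h1 := (hasDerivAt_id z).const_mul a
    have h2 := ((hasDerivAt_pow 2 z).const_mul b).div_const 2
    have h3 := ((hasDerivAt_pow 3 z).const_mul c).div_const 3
    have h4 := ((hasDerivAt_pow 4 z).const_mul d).div_const 4
    have h5 := ((hasDerivAt_pow 5 z).const_mul e).div_const 5
    refine ((((h1.add h2).add h3).add h4).add h5).congr_deriv ?_
    norm_num
    ring
  rw [intervalIntegral.integral_eq_sub_of_hasDerivAt hd
    (Continuous.intervalIntegrable (by fun_prop) _ _)]
  ring

/-- The integral of a product of two affine functions over the unit simplex, in terms of their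
values at the vertices. -/
lemma setIntegral_cornerTetrahedron_affine_mul_affine (p₁ p₂ p₃ p₄ q₁ q₂ q₃ q₄ : ℝ) :
    ∫ p in cornerTetrahedron,
      (p₁ + (p.1 * (p₂ - p₁) + p.2.1 * (p₃ - p₁) + p.2.2 * (p₄ - p₁))) *
      (q₁ + (p.1 * (q₂ - q₁) + p.2.1 * (q₃ - q₁) + p.2.2 * (q₄ - q₁))) =
    ((p₁ + p₂ + p₃ + p₄) * (q₁ + q₂ + q₃ + q₄) +
      (p₁ * q₁ + p₂ * q₂ + p₃ * q₃ + p₄ * q₄)) / 120 := by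
  rw [setIntegral_cornerTetrahedron (by fun_prop)]
  obtain ⟨u₂, rfl⟩ : ∃ u, p₂ = p₁ + u := ⟨p₂ - p₁, by ring⟩
  obtain ⟨u₃, rfl⟩ : ∃ u, p₃ = p₁ + u := ⟨p₃ - p₁, by ring⟩
  obtain ⟨u₄, rfl⟩ : ∃ u, p₄ = p₁ + u := ⟨p₄ - p₁, by ring⟩
  obtain ⟨v₂, rfl⟩ : ∃ u, q₂ = q₁ + u := ⟨q₂ - q₁, by ring⟩
  obtain ⟨v₃, rfl⟩ : ∃ u, q₃ = q₁ + u := ⟨q₃ - q₁, by ring⟩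
  obtain ⟨v₄, rfl⟩ : ∃ u, q₄ = q₁ + u := ⟨q₄ - q₁, by ring⟩
  simp only [add_sub_cancel_left]
  have hz (x y : ℝ) : ∫ z in (0 : ℝ)..(1 - x - y),
      (p₁ + (x * u₂ + y * u₃ + z * u₄)) * (q₁ + (x * v₂ + y * v₃ + z * v₄)) =
      (p₁ + x * u₂ + y * u₃) * (q₁ + x * v₂ + y * v₃) * (1 - x - y) +
      ((p₁ + x * u₂ + y * u₃) * v₄ + (q₁ + x * v₂ + y * v₃) * u₄) * (1 - x - y) ^ 2 / 2 +
      u₄ * v₄ * (1 - x - y) ^ 3 / 3 := by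
    have := intervalIntegral_quartic (1 - x - y) ((p₁ + x * u₂ + y * u₃) * (q₁ + x * v₂ + y * v₃))
      ((p₁ + x * u₂ + y * u₃) * v₄ + (q₁ + x * v₂ + y * v₃) * u₄) (u₄ * v₄) 0 0
    convert this using 1
    · congr 1; ext z; ring
    · ring
  simp only [hz]
  have hy (x : ℝ) : ∫ y in (0 : ℝ)..(1 - x),
      ((p₁ + x * u₂ + y * u₃) * (q₁ + x * v₂ + y * v₃) * (1 - x - y) +
      ((p₁ + x * u₂ + y * u₃) * v₄ + (q₁ + x * v₂ + y * v₃) * u₄) * (1 - x - y) ^ 2 / 2 +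
      u₄ * v₄ * (1 - x - y) ^ 3 / 3) =
      (p₁ + x * u₂) * (q₁ + x * v₂) * (1 - x) ^ 2 / 2 +
      ((p₁ + x * u₂) * (v₃ + v₄) + (q₁ + x * v₂) * (u₃ + u₄)) * (1 - x) ^ 3 / 6 +
      (2 * u₃ * v₃ + u₃ * v₄ + u₄ * v₃ + 2 * u₄ * v₄) * (1 - x) ^ 4 / 24 := by
    obtain ⟨r, hr⟩ : ∃ r, 1 - x = r := ⟨_, rfl⟩
    obtain ⟨P, hP⟩ : ∃ P, p₁ + x * u₂ = P := ⟨_, rfl⟩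
    obtain ⟨Q, hQ⟩ : ∃ Q, q₁ + x * v₂ = Q := ⟨_, rfl⟩
    rw [hr, hP, hQ]
    have := intervalIntegral_quartic r
      (P * Q * r + (P * v₄ + Q * u₄) * r ^ 2 / 2 + u₄ * v₄ * r ^ 3 / 3)
      ((P * v₃ + Q * u₃) * r - P * Q + (u₃ * v₄ + v₃ * u₄) * r ^ 2 / 2
        - (P * v₄ + Q * u₄) * r - u₄ * v₄ * r ^ 2)
      (u₃ * v₃ * r - (P * v₃ + Q * u₃) + (P * v₄ + Q * u₄) / 2 - (u₃ * v₄ + v₃ * u₄) * r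
        + u₄ * v₄ * r)
      (- u₃ * v₃ + (u₃ * v₄ + v₃ * u₄) / 2 - u₄ * v₄ / 3) 0
    convert this using 1
    · congr 1; ext z; ring
    · ring
  simp only [hy]
  obtain ⟨B, hB⟩ : ∃ B, v₃ + v₄ = B := ⟨_, rfl⟩
  obtain ⟨A, hA⟩ : ∃ A, u₃ + u₄ = A := ⟨_, rfl⟩
  obtain ⟨W, hW⟩ : ∃ W, 2 * u₃ * v₃ + u₃ * v₄ + u₄ * v₃ + 2 * u₄ * v₄ = W := ⟨_, rfl⟩
  rw [hA, hB, hW]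
  have := intervalIntegral_quartic 1
    (p₁ * q₁ / 2 + (p₁ * B + q₁ * A) / 6 + W / 24)
    ((p₁ * v₂ + q₁ * u₂) / 2 - p₁ * q₁ + (u₂ * B + v₂ * A) / 6 - (p₁ * B + q₁ * A) / 2 - W / 6)
    (p₁ * q₁ / 2 - (p₁ * v₂ + q₁ * u₂) + u₂ * v₂ / 2 + (p₁ * B + q₁ * A) / 2
      - (u₂ * B + v₂ * A) / 2 + W / 4)
    ((p₁ * v₂ + q₁ * u₂) / 2 - u₂ * v₂ - (p₁ * B + q₁ * A) / 6 + (u₂ * B + v₂ * A) / 2 - W / 6)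
    (u₂ * v₂ / 2 - (u₂ * B + v₂ * A) / 6 + W / 24)
  convert this using 1
  · congr 1; ext z; ring
  · rw [← hA, ← hB, ← hW]; ring

lemma volume_real_cornerTetrahedron : volume.real cornerTetrahedron = 1 / 6 := by
  have := setIntegral_cornerTetrahedron_affine_mul_affine 1 1 1 1 1 1 1 1
  simp only [sub_self, mul_zero, add_zero, mul_one, integral_const, smul_eq_mul,
    measureReal_restrict_apply_univ] at this
  rw [this]
  norm_num

/-- The coordinates of a vector of Euclidean 3-space as a triple. -/
def euclideanCoords : EuclideanSpace ℝ (Fin 3) ≃ᵐ ℝ × ℝ × ℝ :=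
  ((MeasurableEquiv.toLp 2 (Fin 3 → ℝ)).symm.trans
    (MeasurableEquiv.piFinSuccAbove (fun _ ↦ ℝ) 0)).trans
    ((MeasurableEquiv.refl ℝ).prodCongr MeasurableEquiv.finTwoArrow)

lemma euclideanCoords_apply (u : EuclideanSpace ℝ (Fin 3)) :
    euclideanCoords u = (u 0, u 1, u 2) := rfl

lemma measurePreserving_euclideanCoords : MeasurePreserving euclideanCoords :=
  ((MeasurePreserving.id volume).prod (volume_preserving_finTwoArrow ℝ)).comp
    ((volume_preserving_piFinSuccAbove (fun _ : Fin 3 ↦ ℝ) 0).comp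
      (EuclideanSpace.volume_preserving_symm_measurableEquiv_toLp (Fin 3)))

/-- The linear map sending the standard basis of Euclidean 3-space to `v₁, v₂, v₃`. -/
noncomputable def euclideanCombination {E : Type*} [AddCommGroup E] [Module ℝ E] (v₁ v₂ v₃ : E) :
    EuclideanSpace ℝ (Fin 3) →ₗ[ℝ] E where
  toFun u := u 0 • v₁ + u 1 • v₂ + u 2 • v₃
  map_add' u w := by simp only [PiLp.add_apply]; module
  map_smul' c u := by simp only [PiLp.smul_apply, smul_eq_mul, RingHom.id_apply]; module

lemma euclideanCombination_apply {E : Type*} [AddCommGroup E] [Module ℝ E] (v₁ v₂ v₃ : E)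
    (u : EuclideanSpace ℝ (Fin 3)) :
    euclideanCombination v₁ v₂ v₃ u = u 0 • v₁ + u 1 • v₂ + u 2 • v₃ := rfl

lemma injective_euclideanCombination {E : Type*} [AddCommGroup E] [Module ℝ E] {a₁ a₂ a₃ a₄ : E}
    (h : AffineIndependent ℝ ![a₁, a₂, a₃, a₄]) :
    Function.Injective (euclideanCombination (a₂ - a₁) (a₃ - a₁) (a₄ - a₁)) := by
  rw [← LinearMap.ker_eq_bot, LinearMap.ker_eq_bot']
  intro u hu
  rw [euclideanCombination_apply] at hu
  have key := (affineIndependent_iff.1 h) Finset.univ ![-(u 0 + u 1 + u 2), u 0, u 1, u 2]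
    (by simp [Fin.sum_univ_four]; ring)
    (by
      simp only [Fin.sum_univ_four, Matrix.cons_val]
      rw [← hu]
      module)
  ext i
  fin_cases i
  · exact key 1 (Finset.mem_univ _)
  · exact key 2 (Finset.mem_univ _)
  · exact key 3 (Finset.mem_univ _)

lemma convex_euclideanCoords_preimage_cornerTetrahedron :
    Convex ℝ (euclideanCoords ⁻¹' cornerTetrahedron) := by
  rintro u ⟨hu1, hu2, hu3, hu4⟩ w ⟨hw1, hw2, hw3, hw4⟩ a b ha hb hab
  simp only [euclideanCoords_apply] at hu1 hu2 hu3 hu4 hw1 hw2 hw3 hw4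
  simp only [Set.mem_preimage, euclideanCoords_apply, cornerTetrahedron, Set.mem_ofPred_eq,
    PiLp.add_apply, PiLp.smul_apply, smul_eq_mul]
  refine ⟨by positivity, by positivity, by positivity, ?_⟩
  nlinarith [mul_le_mul_of_nonneg_left hu4 ha, mul_le_mul_of_nonneg_left hw4 hb]

lemma convexHull_eq_image_cornerTetrahedron {E : Type*} [AddCommGroup E] [Module ℝ E]
    (a₁ a₂ a₃ a₄ : E) :
    convexHull ℝ {a₁, a₂, a₃, a₄} =
      (fun u ↦ a₁ + euclideanCombination (a₂ - a₁) (a₃ - a₁) (a₄ - a₁) u) ''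
        (euclideanCoords ⁻¹' cornerTetrahedron) := by
  apply Set.Subset.antisymm
  · apply convexHull_min
    · rintro x (rfl | rfl | rfl | rfl)
      · refine ⟨!₂[0, 0, 0], ?_, ?_⟩ <;>
          simp [euclideanCoords_apply, cornerTetrahedron, euclideanCombination_apply]
      · refine ⟨!₂[1, 0, 0], ?_, ?_⟩ <;>
          simp [euclideanCoords_apply, cornerTetrahedron, euclideanCombination_apply]
      · refine ⟨!₂[0, 1, 0], ?_, ?_⟩ <;>
          simp [euclideanCoords_apply, cornerTetrahedron, euclideanCombination_apply]
      · refine ⟨!₂[0, 0, 1], ?_, ?_⟩ <;>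
          simp [euclideanCoords_apply, cornerTetrahedron, euclideanCombination_apply]
    · have := (convex_euclideanCoords_preimage_cornerTetrahedron.linear_image
        (euclideanCombination (a₂ - a₁) (a₃ - a₁) (a₄ - a₁))).translate a₁
      rwa [Set.image_image] at this
  · rintro _ ⟨u, ⟨h1, h2, h3, h4⟩, rfl⟩
    simp only [euclideanCoords_apply] at h1 h2 h3 h4
    have := (convex_convexHull ℝ {a₁, a₂, a₃, a₄}).sum_mem (t := Finset.univ)
      (w := ![1 - (u 0 + u 1 + u 2), u 0, u 1, u 2]) (z := ![a₁, a₂, a₃, a₄])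
      (by
        intro i _
        fin_cases i
        · exact sub_nonneg.2 h4
        · exact h1
        · exact h2
        · exact h3)
      (by simp [Fin.sum_univ_four]; ring)
      (by
        intro i _
        apply subset_convexHull
        fin_cases i <;> simp)
    convert this using 1
    simp only [euclideanCombination_apply, Fin.sum_univ_four, Matrix.cons_val]
    module


theorem stmt_5 (a₁ a₂ a₃ a₄ : EuclideanSpace ℝ (Fin 3))
    (h : AffineIndependent ℝ ![a₁, a₂, a₃, a₄]) :
    ∫ x in convexHull ℝ {a₁, a₂, a₃, a₄}, (x 0 * x 1) =
      (volume (convexHull ℝ {a₁, a₂, a₃, a₄} : Set (EuclideanSpace ℝ (Fin 3)))).toReal *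
        (2 * a₁ 0 * a₁ 1 + a₂ 0 * a₁ 1 + a₃ 0 * a₁ 1 + a₄ 0 * a₁ 1 + a₁ 0 * a₂ 1 + 2 * a₂ 0 * a₂ 1 + a₃ 0 * a₂ 1 + a₄ 0 * a₂ 1 + a₁ 0 * a₃ 1 + a₂ 0 * a₃ 1 + 2 * a₃ 0 * a₃ 1 + a₄ 0 * a₃ 1 + a₁ 0 * a₄ 1 + a₂ 0 * a₄ 1 + a₃ 0 * a₄ 1 + 2 * a₄ 0 * a₄ 1) / 20 := by
  set L := euclideanCombination (a₂ - a₁) (a₃ - a₁) (a₄ - a₁) with hL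
  set S := euclideanCoords ⁻¹' cornerTetrahedron with hS
  have hT : MeasurableSet cornerTetrahedron := isCompact_cornerTetrahedron.measurableSet
  have hSm : MeasurableSet S := euclideanCoords.measurable hT
  have hd (u) (_ : u ∈ S) : HasFDerivWithinAt (fun u ↦ a₁ + L u)
      (LinearMap.toContinuousLinearMap L) S u :=
    ((LinearMap.toContinuousLinearMap L).hasFDerivAt.const_add a₁).hasFDerivWithinAt
  have hinj : Set.InjOn (fun u ↦ a₁ + L u) S :=
    ((add_right_injective a₁).comp (injective_euclideanCombination h)).injOn
  have change (F : EuclideanSpace ℝ (Fin 3) → ℝ) :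
      ∫ x in convexHull ℝ {a₁, a₂, a₃, a₄}, F x = |L.det| * ∫ u in S, F (a₁ + L u) := by
    rw [convexHull_eq_image_cornerTetrahedron,
      integral_image_eq_integral_abs_det_fderiv_smul volume hSm hd hinj, ← integral_const_mul]
    rfl
  have hvol : (volume (convexHull ℝ {a₁, a₂, a₃, a₄})).toReal = |L.det| * (1 / 6) := by
    have := change fun _ ↦ 1
    simp only [integral_const, smul_eq_mul, mul_one, measureReal_restrict_apply_univ] at this
    rw [← volume_real_cornerTetrahedron, ← measureReal_def, this, measureReal_def, hS,
      measurePreserving_euclideanCoords.measure_preimage hT.nullMeasurableSet, ← measureReal_def]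
  rw [hvol, change]
  have := measurePreserving_euclideanCoords.setIntegral_preimage_emb
    euclideanCoords.measurableEmbedding
    (fun p ↦ (a₁ 0 + (p.1 * (a₂ 0 - a₁ 0) + p.2.1 * (a₃ 0 - a₁ 0) + p.2.2 * (a₄ 0 - a₁ 0))) *
      (a₁ 1 + (p.1 * (a₂ 1 - a₁ 1) + p.2.1 * (a₃ 1 - a₁ 1) + p.2.2 * (a₄ 1 - a₁ 1))))
    cornerTetrahedron
  rw [setIntegral_cornerTetrahedron_affine_mul_affine] at this
  simp only [euclideanCoords_apply] at this
  simp only [hL, euclideanCombination_apply, PiLp.add_apply, PiLp.sub_apply, PiLp.smul_apply,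
    smul_eq_mul]
  rw [hS, this]
  ring
end
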